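/- Stein's identity on Banach spaces: Let (V, ‖·‖) be a separable Banach space, let v: V → V* be a bounded, continuously Fréchet-differentiable function with bounded derivative, and let ρ be a centered V-valued Gaussian random variable with ρ' an independent copy of ρ. Then E[v(ρ)[ρ]] = E[(Dv(ρ)[ρ'])[ρ']], where both expectations exist in the Bochner sense. -/

import Mathlib

open MeasureTheory ProbabilityTheory

/-- A random variable valued in a Banach space is a *centered Gaussian* random variable if
every continuous linear functional of it has a centered real Gaussian distribution. -/
def IsCenteredGaussianRV {Ω : Type*} [MeasurableSpace Ω] {V : Type*}
    [NormedAddCommGroup V] [NormedSpace ℝ V] [MeasurableSpace V]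
    (P : Measure Ω) (φ : Ω → V) : Prop :=
  Measurable φ ∧ ∀ L : V →L[ℝ] ℝ, ∃ v : NNReal,
    Measure.map (fun ω => L (φ ω)) P = gaussianReal 0 v

/-- If the product measure `μ.prod μ` is invariant under rotations and `μ` has a second moment,
then Stein's identity holds for `μ`: differentiate the constant map
`θ ↦ ∫ v (cos θ • x + sin θ • y) (-sin θ • x + cos θ • y)` at `θ = 0`. -/
theorem integral_prod_fderiv_apply_apply_of_map_rotation_eq_self
    {V : Type*} [NormedAddCommGroup V] [NormedSpace ℝ V]
    [TopologicalSpace.SeparableSpace V] [MeasurableSpace V] [BorelSpace V]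
    {μ : Measure V} [IsProbabilityMeasure μ] (hμ2 : MemLp id 2 μ)
    (hrot : ∀ θ : ℝ, (μ.prod μ).map (ContinuousLinearMap.rotation θ) = μ.prod μ)
    {v : V → (V →L[ℝ] ℝ)} {C D : ℝ} (hC : ∀ x, ‖v x‖ ≤ C) (hv : ContDiff ℝ 1 v)
    (hD : ∀ x, ‖fderiv ℝ v x‖ ≤ D) :
    ∫ z : V × V, (fderiv ℝ v z.1 z.2) z.2 ∂(μ.prod μ) = ∫ x, v x x ∂μ := by
  have : SecondCountableTopology V := UniformSpace.secondCountable_of_separable V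
  have hvc : Continuous v := hv.continuous
  have hDc : Continuous (fderiv ℝ v) := hv.continuous_fderiv one_ne_zero
  let X : ℝ → V × V → V := fun θ z => Real.cos θ • z.1 + Real.sin θ • z.2
  let Y : ℝ → V × V → V := fun θ z => -Real.sin θ • z.1 + Real.cos θ • z.2
  have hXn (θ z) : ‖X θ z‖ ≤ ‖z.1‖ + ‖z.2‖ := by
    refine norm_add_le_of_le ?_ ?_ <;> rw [norm_smul] <;>
      refine mul_le_of_le_one_left (norm_nonneg _) ?_
    exacts [Real.abs_cos_le_one θ, Real.abs_sin_le_one θ]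
  have hYn (θ z) : ‖Y θ z‖ ≤ ‖z.1‖ + ‖z.2‖ := by
    refine norm_add_le_of_le ?_ ?_ <;> rw [norm_smul] <;>
      refine mul_le_of_le_one_left (norm_nonneg _) ?_
    exacts [(norm_neg _).trans_le (Real.abs_sin_le_one θ), Real.abs_cos_le_one θ]
  have hXd (θ z) : HasDerivAt (X · z) (Y θ z) θ :=
    ((Real.hasDerivAt_cos θ).smul_const z.1).add ((Real.hasDerivAt_sin θ).smul_const z.2)
  have hYd (θ z) : HasDerivAt (Y · z) (-X θ z) θ := by
    convert! ((Real.hasDerivAt_sin θ).neg.smul_const z.1).add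
      ((Real.hasDerivAt_cos θ).smul_const z.2) using 1
    simp only [X, neg_add, neg_smul]
  let F : ℝ → V × V → ℝ := fun θ z => v (X θ z) (Y θ z)
  let F' : ℝ → V × V → ℝ := fun θ z => (fderiv ℝ v (X θ z) (Y θ z)) (Y θ z) - v (X θ z) (X θ z)
  have hFc (θ) : Continuous (F θ) := by fun_prop
  have hF'c (θ) : Continuous (F' θ) := by fun_prop
  have hn : MemLp (fun z : V × V => ‖z.1‖ + ‖z.2‖) 2 (μ.prod μ) :=
    (hμ2.norm.comp_fst μ).add (hμ2.norm.comp_snd μ)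
  have hn1 : Integrable (fun z : V × V => ‖z.1‖ + ‖z.2‖) (μ.prod μ) :=
    hn.integrable one_le_two
  have hFd (θ z) : HasDerivAt (F · z) (F' θ z) θ := by
    have h1 : HasDerivAt (fun t => v (X t z)) (fderiv ℝ v (X θ z) (Y θ z)) θ :=
      ((hv.differentiable one_ne_zero) (X θ z)).hasFDerivAt.comp_hasDerivAt θ (hXd θ z)
    convert! h1.clm_apply (hYd θ z) using 1
    simp [F', sub_eq_add_neg]
  have hvX (θ z) : ‖v (X θ z) (X θ z)‖ ≤ C * (‖z.1‖ + ‖z.2‖) :=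
    (v (X θ z)).le_of_opNorm_le_of_le (hC _) (hXn θ z)
  have hFn (z) : ‖F 0 z‖ ≤ C * (‖z.1‖ + ‖z.2‖) :=
    (v (X 0 z)).le_of_opNorm_le_of_le (hC _) (hYn 0 z)
  have hF'n (θ z) : ‖F' θ z‖ ≤ D * (‖z.1‖ + ‖z.2‖) ^ 2 + C * (‖z.1‖ + ‖z.2‖) := by
    refine norm_sub_le_of_le ?_ (hvX θ z)
    rw [pow_two, ← mul_assoc]
    exact ContinuousLinearMap.le_of_opNorm_le_of_le _
      (ContinuousLinearMap.le_of_opNorm_le_of_le _ (hD _) (hYn θ z)) (hYn θ z)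
  obtain ⟨hF'i, hder⟩ := hasDerivAt_integral_of_dominated_loc_of_deriv_le
    (F := F) (F' := F') (μ := μ.prod μ) (x₀ := (0 : ℝ)) Filter.univ_mem
    (.of_forall fun θ => (hFc θ).aestronglyMeasurable)
    ((hn1.const_mul C).mono' (hFc 0).aestronglyMeasurable (.of_forall hFn))
    (hF'c 0).aestronglyMeasurable (.of_forall fun z θ _ => hF'n θ z)
    ((hn.integrable_sq.const_mul D).add (hn1.const_mul C))
    (.of_forall fun z θ _ => hFd θ z)
  have hconst (θ) : ∫ z, F θ z ∂(μ.prod μ) = ∫ z : V × V, v z.1 z.2 ∂(μ.prod μ) := by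
    conv_rhs => rw [← hrot θ]
    rw [integral_map (by fun_prop) (by fun_prop)]
    rfl
  have h0 : ∫ z, F' 0 z ∂(μ.prod μ) = 0 := by
    simp_rw [hconst] at hder
    exact hder.unique (hasDerivAt_const _ _)
  have hvi : Integrable (fun z : V × V => v z.1 z.1) (μ.prod μ) := by
    refine (hn1.const_mul C).mono' (by fun_prop) (.of_forall fun z => ?_)
    simpa [X] using hvX 0 z
  have hDi : Integrable (fun z : V × V => (fderiv ℝ v z.1 z.2) z.2) (μ.prod μ) := by
    simpa [F', X, Y, Pi.add_def] using! hF'i.add hvi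
  simp only [F', X, Y, Real.cos_zero, Real.sin_zero, one_smul, zero_smul, neg_zero, zero_add,
    add_zero] at h0
  rw [integral_sub hDi hvi, sub_eq_zero] at h0
  rw [h0, integral_fun_fst (fun x => v x x)]
  simp

/-- **Stein's identity on Banach spaces.**  Let `V` be a separable Banach space,
`v : V → V*` a bounded, continuously Fréchet-differentiable map with bounded derivative, and
`ρ` a centered `V`-valued Gaussian random variable with `ρ'` an independent copy of `ρ`.
Then `E[v(ρ)[ρ]] = E[(Dv(ρ)[ρ'])[ρ']]`. -/
theorem stein_identity_banach
    {Ω : Type*} [MeasurableSpace Ω] (P : Measure Ω) [IsProbabilityMeasure P]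
    {V : Type*} [NormedAddCommGroup V] [NormedSpace ℝ V] [CompleteSpace V]
    [TopologicalSpace.SeparableSpace V] [MeasurableSpace V] [BorelSpace V]
    (v : V → (V →L[ℝ] ℝ))
    (hv_bd : ∃ C : ℝ, ∀ x : V, ‖v x‖ ≤ C)
    (hv_diff : ContDiff ℝ 1 v)
    (hDv_bd : ∃ C : ℝ, ∀ x : V, ‖fderiv ℝ v x‖ ≤ C)
    (ρ ρ' : Ω → V)
    (hρ : IsCenteredGaussianRV P ρ)
    (hρ' : Measurable ρ')
    (hcopy : Measure.map ρ' P = Measure.map ρ P)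
    (hindep : IndepFun ρ ρ' P) :
    (∫ ω, v (ρ ω) (ρ ω) ∂P) = ∫ ω, (fderiv ℝ v (ρ ω) (ρ' ω)) (ρ' ω) ∂P := by
  obtain ⟨C, hC⟩ := hv_bd
  obtain ⟨D, hD⟩ := hDv_bd
  obtain ⟨hρm, hρg⟩ := hρ
  have : SecondCountableTopology V := UniformSpace.secondCountable_of_separable V
  have hlaw (L : V →L[ℝ] ℝ) : ∃ s : NNReal, (P.map ρ).map L = gaussianReal 0 s := by
    obtain ⟨s, hs⟩ := hρg L
    exact ⟨s, by rwa [Measure.map_map L.measurable hρm]⟩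
  have : IsGaussian (P.map ρ) := isGaussian_of_map_eq_gaussianReal fun L => ⟨0, hlaw L⟩
  have hmean (L : StrongDual ℝ V) : (P.map ρ)[L] = 0 := by
    obtain ⟨s, hs⟩ := hlaw L
    have h : ∫ x, x ∂((P.map ρ).map L) = (P.map ρ)[L] :=
      integral_map L.measurable.aemeasurable (by fun_prop)
    rw [← h, hs, integral_id_gaussianReal]
  have hjoint : P.map (fun ω => (ρ ω, ρ' ω)) = (P.map ρ).prod (P.map ρ) := by
    rw [(indepFun_iff_map_prod_eq_prod_map_map hρm.aemeasurable hρ'.aemeasurable).1 hindep, hcopy]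
  have hvc : Continuous v := hv_diff.continuous
  have hDc : Continuous (fderiv ℝ v) := hv_diff.continuous_fderiv one_ne_zero
  have hstein := integral_prod_fderiv_apply_apply_of_map_rotation_eq_self
    IsGaussian.memLp_two_id
    (IsGaussian.map_rotation_eq_self_of_forall_strongDual_eq_zero hmean) hC hv_diff hD
  rw [← hjoint, integral_map (by fun_prop) (by fun_prop),
    integral_map hρm.aemeasurable (by fun_prop)] at hstein
  exact hstein.symm
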